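/- In the toy instance with non-monotonic cost matrix c = [[0,0.2,0.3],[0.3,0,0.7],[1.2,1.1,0]], for every a ∈ [0, 0.7] the policy π_a given by π_a(x_1) = 1, π_a(x_2) = a, π_a(x_3) = 1 is optimal: u(π_a, 0.1) = 0.6 and u(π, 0.1) ≤ 0.6 for every decision policy π : {1,2,3} → [0,1]. -/

import Mathlib

open scoped Classical

/-- The best response of an individual with features `x i` to policy `π` under cost `c`:
the element of `argmax_k (π k - c i k)` with the highest outcome and, among maximizers
with equal outcome, the lowest index.  Since indices are sorted in decreasing order of
outcome, this is the minimal index among the maximizers. -/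
noncomputable def bestResponse {m : ℕ} [NeZero m] (c : Fin m → Fin m → ℝ)
    (π : Fin m → ℝ) (i : Fin m) : Fin m :=
  (Finset.univ.filter (fun k => ∀ l, π l - c i l ≤ π k - c i k)).min' (by
    obtain ⟨k, -, hk⟩ := Finset.exists_max_image Finset.univ (fun k => π k - c i k)
      ⟨i, Finset.mem_univ i⟩
    exact ⟨k, Finset.mem_filter.mpr ⟨Finset.mem_univ k, fun l => hk l (Finset.mem_univ l)⟩⟩)

/-- The utility of a decision policy `π`:  `u(π,γ) = Σ_i P(x_i) · π(x_{br_π(i)}) · (q_{br_π(i)} − γ)`. -/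
noncomputable def utility {m : ℕ} [NeZero m] (P q : Fin m → ℝ) (c : Fin m → Fin m → ℝ)
    (γ : ℝ) (π : Fin m → ℝ) : ℝ :=
  ∑ i, P i * π (bestResponse c π i) * (q (bestResponse c π i) - γ)

/-- A decision policy takes values in `[0,1]`. -/
def IsPolicy {m : ℕ} (π : Fin m → ℝ) : Prop := ∀ i, 0 ≤ π i ∧ π i ≤ 1


/-- The non-monotonic cost matrix of the second toy instance:
`c = [[0,0.2,0.3],[0.3,0,0.7],[1.2,1.1,0]]`. -/
noncomputable def toyCost2 : Fin 3 → Fin 3 → ℝ :=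
  ![![0, 0.2, 0.3], ![0.3, 0, 0.7], ![1.2, 1.1, 0]]

/-- The utility in the second toy instance with `P = (0.1, 0.4, 0.5)`,
`q = (1, 0.7, 0.4)`, `γ = 0.1` and the cost matrix `toyCost2`. -/
noncomputable def toyUtility2 (π : Fin 3 → ℝ) : ℝ :=
  utility ![0.1, 0.4, 0.5] ![1, 0.7, 0.4] toyCost2 0.1 π

theorem bestResponse_spec {m : ℕ} [NeZero m] (c : Fin m → Fin m → ℝ) (π : Fin m → ℝ)
    (i l : Fin m) : π l - c i l ≤ π (bestResponse c π i) - c i (bestResponse c π i) :=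
  (Finset.mem_filter.mp (Finset.min'_mem (Finset.univ.filter
    (fun k => ∀ l, π l - c i l ≤ π k - c i k)) _)).2 l

theorem bestResponse_le {m : ℕ} [NeZero m] {c : Fin m → Fin m → ℝ} {π : Fin m → ℝ}
    {i k : Fin m} (h : ∀ l, π l - c i l ≤ π k - c i k) : bestResponse c π i ≤ k :=
  Finset.min'_le _ _ (Finset.mem_filter.mpr ⟨Finset.mem_univ k, h⟩)

theorem bestResponse_toyCost2_two {π : Fin 3 → ℝ} (hπ : ∀ i, 0 ≤ π i ∧ π i ≤ 1) :
    bestResponse toyCost2 π 2 = 2 := by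
  have h := bestResponse_spec toyCost2 π 2 2
  generalize bestResponse toyCost2 π 2 = b at h ⊢
  have h0 := hπ 0
  have h1 := hπ 1
  have h2 := hπ 2
  fin_cases b
  · change π 2 - 0 ≤ π 0 - 1.2 at h
    norm_num at h
    linarith
  · change π 2 - 0 ≤ π 1 - 1.1 at h
    norm_num at h
    linarith
  · rfl

/-- In the second toy instance (non-monotonic costs), for every `a ∈ [0, 0.7]` the
policy `π_a = (1, a, 1)` is optimal: `u(π_a, 0.1) = 0.6`, and every decision policy has
utility at most `0.6`. -/
theorem stmt14 :
    (∀ a : ℝ, 0 ≤ a → a ≤ 0.7 → toyUtility2 ![1, a, 1] = 0.6) ∧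
    ∀ π : Fin 3 → ℝ, (∀ i, 0 ≤ π i ∧ π i ≤ 1) → toyUtility2 π ≤ 0.6 := by
  refine ⟨fun a h0 h1 => ?_, fun π hπ => ?_⟩
  · norm_num at h1
    have b0 : bestResponse toyCost2 ![1, a, 1] 0 = 0 :=
      Fin.le_zero_iff.mp (bestResponse_le fun l => by
        fin_cases l <;> norm_num [toyCost2]; linarith)
    have b1 : bestResponse toyCost2 ![1, a, 1] 1 = 0 :=
      Fin.le_zero_iff.mp (bestResponse_le fun l => by
        fin_cases l <;> norm_num [toyCost2]; linarith)
    have b2 : bestResponse toyCost2 ![1, a, 1] 2 = 2 :=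
      bestResponse_toyCost2_two fun i => by
        fin_cases i <;> norm_num
        exact ⟨h0, by linarith⟩
    simp only [toyUtility2, utility, Fin.sum_univ_three, b0, b1, b2, Matrix.cons_val]
    norm_num
  · have key : ∀ k : Fin 3, π k * ((![1, 0.7, 0.4] : Fin 3 → ℝ) k - 0.1) ≤ 0.9 := by
      intro k
      have := hπ k
      fin_cases k <;> norm_num at this ⊢ <;> linarith
    have k0 := key (bestResponse toyCost2 π 0)
    have k1 := key (bestResponse toyCost2 π 1)
    have h2 := hπ 2
    simp only [toyUtility2, utility, Fin.sum_univ_three, bestResponse_toyCost2_two hπ, mul_assoc,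
      Matrix.cons_val]
    norm_num at k0 k1 ⊢
    linarith
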